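/- arXiv:2002.11751 — 2 statements merged into one kernel-verified Lean document; each statement's English description precedes it below -/
import Mathlib

section
/- Let U : K₁ ⥤ K₂ be a categorical precompact expansion of categories satisfying the homogeneous condition: for every object A of K₂ there exists an object B of K₂ such that (B^i choose A^j) is nonempty for every expansion B^i of B and every expansion A^j of A. If every object of K₁ has Ramsey degree 1 in K₁ (i.e. K₁ has the Ramsey property), then for every object A of K₂ the Ramsey degree of A in K₂ equals its number of expansions: t_{K₂}(A) = m(A). -/
open CategoryTheory

universe v₁ v₂ u₁ u₂ v u

namespace CatRamsey

variable {C : Type u} [Category.{v} C]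

/-- Two morphisms `f, h : A ⟶ B` are equivalent if `f ∘ g = h` for some automorphism `g` of `A`. -/
def copySetoid (A B : C) : Setoid (A ⟶ B) where
  r f h := ∃ g : A ≅ A, g.hom ≫ f = h
  iseqv := by
    constructor
    · intro f
      exact ⟨Iso.refl A, by simp⟩
    · rintro f h ⟨g, hg⟩
      refine ⟨g.symm, ?_⟩
      rw [← hg, ← Category.assoc, Iso.symm_hom, g.inv_hom_id, Category.id_comp]
    · rintro f h k ⟨g₁, h₁⟩ ⟨g₂, h₂⟩
      exact ⟨g₂ ≪≫ g₁, by rw [Iso.trans_hom, Category.assoc, h₁, h₂]⟩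

/-- The set of copies of `A` in `B`: `Hom(A,B)` modulo precomposition with automorphisms. -/
def Copies (A B : C) := Quotient (copySetoid A B)

/-- The copy determined by a morphism. -/
def copyMk {A B : C} (f : A ⟶ B) : Copies A B := Quotient.mk (copySetoid A B) f

/-- `D → (B)^A_{k,t}` : for every colouring `χ` of the copies of `A` in `D` with `k` colours,
there is `f : B ⟶ D` such that `χ` takes at most `t` values on the copies of `A` in the
image of `B` under `f`. -/
def ArrowsRamsey (A B D : C) (k t : ℕ) : Prop :=
  ∀ χ : Copies A D → Fin k, ∃ f : B ⟶ D,
    (χ '' {c : Copies A D | ∃ h : A ⟶ B, c = copyMk (h ≫ f)}).ncard ≤ t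

/-- The Ramsey degree of `A` in `C` : the least `t` such that for every `B` and every number
of colours `k` there is a `D` with `D → (B)^A_{k,t}`; `⊤` if no such `t` exists. -/
noncomputable def ramseyDegree (A : C) : ℕ∞ :=
  sInf {t : ℕ∞ | ∃ t' : ℕ, t = (t' : ℕ∞) ∧ ∀ (B : C) (k : ℕ), ∃ D : C, ArrowsRamsey A B D k t'}

/-- An expansion functor: faithful (C), surjective on objects (Proj), and satisfying the
reflection condition (Ref) with a unique reflecting expansion. -/
def IsExpansionFunctor {K₁ : Type u₁} {K₂ : Type u₂} [Category.{v₁} K₁] [Category.{v₂} K₂]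
    (U : K₁ ⥤ K₂) : Prop :=
  (∀ (A B : K₁), Function.Injective (fun f : A ⟶ B => U.map f)) ∧
  (∀ A : K₂, ∃ A' : K₁, U.obj A' = A) ∧
  (∀ (A B : K₂) (f : A ⟶ B) (B' : K₁) (hB : U.obj B' = B),
    ∃ (A' : K₁) (hA : U.obj A' = A),
      (∃ (f' : A' ⟶ B') (g : A ≅ A), g.hom ≫ eqToHom hA.symm ≫ U.map f' ≫ eqToHom hB = f) ∧
      ∀ (A'' : K₁) (hA' : U.obj A'' = A),
        (∃ (f' : A'' ⟶ B') (g : A ≅ A),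
          g.hom ≫ eqToHom hA'.symm ≫ U.map f' ≫ eqToHom hB = f) → A'' = A')

/-- A categorical precompact expansion: an expansion functor all of whose fibres on objects
are finite. -/
def IsPrecompactExpansion {K₁ : Type u₁} {K₂ : Type u₂} [Category.{v₁} K₁] [Category.{v₂} K₂]
    (U : K₁ ⥤ K₂) : Prop :=
  IsExpansionFunctor U ∧ ∀ A : K₂, Finite {A' : K₁ // U.obj A' = A}

end CatRamsey

namespace CatRamsey

section Copies

variable {C : Type u} [Category.{v} C]

/-- Pushing copies forward along a morphism. -/
def Copies.push (A : C) {B D : C} (f : B ⟶ D) : Copies A B → Copies A D :=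
  Quotient.map (fun h => h ≫ f) (by
    rintro h _ ⟨g, rfl⟩
    exact ⟨g, (Category.assoc _ _ _).symm⟩)

theorem Copies.push_copyMk {A B D : C} (f : B ⟶ D) (h : A ⟶ B) :
    Copies.push A f (copyMk h) = copyMk (h ≫ f) := rfl

theorem copyMk_iso_hom_comp {A B : C} (g : A ≅ A) (f : A ⟶ B) :
    copyMk (g.hom ≫ f) = copyMk f :=
  (Quotient.sound (s := copySetoid A B) ⟨g, rfl⟩).symm

/-- Ramsey degree one yields monochromatic morphisms. -/
theorem exists_monochromatic_of_ramseyDegree_eq_one {A : C} (hA : ramseyDegree A = 1)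
    (B : C) (k : ℕ) : ∃ D : C, ∀ χ : Copies A D → Fin k, ∃ f : B ⟶ D,
      ∀ h h' : A ⟶ B, χ (copyMk (h ≫ f)) = χ (copyMk (h' ≫ f)) := by
  unfold ramseyDegree at hA
  have hne : {t : ℕ∞ | ∃ t' : ℕ, t = (t' : ℕ∞) ∧
      ∀ (B : C) (k : ℕ), ∃ D : C, ArrowsRamsey A B D k t'}.Nonempty := by
    by_contra hempty
    rw [Set.not_nonempty_iff_eq_empty] at hempty
    rw [hempty, sInf_empty] at hA
    exact absurd hA (by simp)
  obtain ⟨t', ht', hram⟩ := csInf_mem hne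
  obtain rfl : t' = 1 := by
    rw [hA] at ht'
    exact_mod_cast ht'.symm
  obtain ⟨D, hD⟩ := hram B k
  refine ⟨D, fun χ => ?_⟩
  obtain ⟨f, hf⟩ := hD χ
  refine ⟨f, fun h h' => ?_⟩
  exact (Set.ncard_le_one (Set.toFinite _)).1 hf _ ⟨_, ⟨h, rfl⟩, rfl⟩ _ ⟨_, ⟨h', rfl⟩, rfl⟩

/-- If all objects have Ramsey degree one, finitely many colourings, of the copies of finitely many
objects, can be made monochromatic simultaneously. -/
theorem exists_simultaneously_monochromatic (hRP : ∀ A : C, ramseyDegree A = 1)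
    {ι : Type*} (obj : ι → C) (B : C) (k : ℕ) (s : Finset ι) :
    ∃ D : C, ∀ χ : ∀ i, Copies (obj i) D → Fin k, ∃ f : B ⟶ D,
      ∀ i ∈ s, ∀ h h' : obj i ⟶ B, χ i (copyMk (h ≫ f)) = χ i (copyMk (h' ≫ f)) := by
  classical
  induction s using Finset.induction_on with
  | empty => exact ⟨B, fun _ => ⟨𝟙 B, by simp⟩⟩
  | insert a s _ ih =>
    obtain ⟨D₀, hD₀⟩ := ih
    obtain ⟨D, hD⟩ := exists_monochromatic_of_ramseyDegree_eq_one (hRP (obj a)) D₀ k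
    refine ⟨D, fun χ => ?_⟩
    obtain ⟨f₀, hf₀⟩ := hD (χ a)
    obtain ⟨f, hf⟩ := hD₀ (fun i c => χ i (Copies.push (obj i) f₀ c))
    refine ⟨f ≫ f₀, fun i hi h h' => ?_⟩
    rcases Finset.mem_insert.1 hi with rfl | hi
    · simpa only [Category.assoc] using hf₀ (h ≫ f) (h' ≫ f)
    · simpa only [Copies.push_copyMk, Category.assoc] using hf i hi h h'

end Copies

section Expansion

variable {K₁ : Type u₁} {K₂ : Type u₂} [Category.{v₁} K₁] [Category.{v₂} K₂]

/-- The copies of the underlying object induced by the copies of an expansion. -/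
def Copies.forget (U : K₁ ⥤ K₂) {A' : K₁} {A : K₂} (hA : U.obj A' = A) (D : K₁) :
    Copies A' D → Copies A (U.obj D) :=
  Quotient.map (fun f => eqToHom hA.symm ≫ U.map f) (by
    subst hA
    rintro h _ ⟨g, rfl⟩
    exact ⟨U.mapIso g, by simp⟩)

theorem Copies.forget_copyMk (U : K₁ ⥤ K₂) {A' : K₁} {A : K₂} (hA : U.obj A' = A) {D : K₁}
    (f : A' ⟶ D) :
    Copies.forget U hA D (copyMk f) = copyMk (eqToHom hA.symm ≫ U.map f) := rfl

/-- `Reflects U f A'` says that, up to an automorphism of its source, `f` lifts to a morphism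
from the expansion `A'` of the source to `D`. -/
def Reflects (U : K₁ ⥤ K₂) {A : K₂} {D : K₁} (f : A ⟶ U.obj D)
    (A' : {A' : K₁ // U.obj A' = A}) : Prop :=
  ∃ (f' : A'.1 ⟶ D) (g : A ≅ A), g.hom ≫ eqToHom A'.2.symm ≫ U.map f' = f

theorem Reflects.iso_hom_comp {U : K₁ ⥤ K₂} {A : K₂} {D : K₁} {f : A ⟶ U.obj D}
    {A' : {A' : K₁ // U.obj A' = A}} (h : Reflects U f A') (g : A ≅ A) :
    Reflects U (g.hom ≫ f) A' := by
  obtain ⟨f', g', rfl⟩ := h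
  exact ⟨f', g ≪≫ g', by simp⟩

theorem IsExpansionFunctor.existsUnique_reflects {U : K₁ ⥤ K₂} (hU : IsExpansionFunctor U)
    {A : K₂} {D : K₁} (f : A ⟶ U.obj D) : ∃! A', Reflects U f A' := by
  obtain ⟨A', hA, ⟨f', g, hf⟩, huniq⟩ := hU.2.2 A _ f D rfl
  refine ⟨⟨A', hA⟩, ⟨f', g, by simpa using hf⟩, ?_⟩
  rintro ⟨A'', hA''⟩ ⟨f'', g'', hf''⟩
  exact Subtype.ext (huniq A'' hA'' ⟨f'', g'', by simpa using hf''⟩)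

/-- The colouring of the copies of `A` in `U.obj D` by the expansions of `A`. -/
theorem IsExpansionFunctor.exists_expansion_coloring {U : K₁ ⥤ K₂} (hU : IsExpansionFunctor U)
    (A : K₂) (D : K₁) : ∃ χ : Copies A (U.obj D) → {A' : K₁ // U.obj A' = A},
      ∀ (f : A ⟶ U.obj D) A', Reflects U f A' → χ (copyMk f) = A' := by
  choose c hc huniq using fun f : A ⟶ U.obj D => hU.existsUnique_reflects f
  refine ⟨Quotient.lift c ?_, fun f A' h => (huniq f A' h).symm⟩
  rintro f _ ⟨g, rfl⟩
  exact huniq _ _ ((hc f).iso_hom_comp g)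

theorem IsPrecompactExpansion.exists_arrowsRamsey {U : K₁ ⥤ K₂} (hU : IsPrecompactExpansion U)
    (hRP : ∀ A₁ : K₁, ramseyDegree A₁ = 1) (A B : K₂) (k : ℕ) :
    ∃ D : K₂, ArrowsRamsey A B D k (Nat.card {A' : K₁ // U.obj A' = A}) := by
  have hfin := hU.2 A
  have := Fintype.ofFinite {A' : K₁ // U.obj A' = A}
  obtain ⟨B, rfl⟩ := hU.1.2.1 B
  obtain ⟨D, hD⟩ := exists_simultaneously_monochromatic hRP
    (fun A' : {A' : K₁ // U.obj A' = A} => A'.1) B k Finset.univ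
  refine ⟨U.obj D, fun χ => ?_⟩
  obtain ⟨f, hf⟩ := hD (fun A' c => χ (Copies.forget U A'.2 D c))
  refine ⟨U.map f, ?_⟩
  have hlift : ∀ x : χ '' {c | ∃ h : A ⟶ U.obj B, c = copyMk (h ≫ U.map f)},
      ∃ (A' : {A' : K₁ // U.obj A' = A}) (h' : A'.1 ⟶ B),
        χ (Copies.forget U A'.2 D (copyMk (h' ≫ f))) = x := by
    rintro ⟨_, _, ⟨h, rfl⟩, rfl⟩
    obtain ⟨A', ⟨h', g, rfl⟩, -⟩ := hU.1.existsUnique_reflects h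
    refine ⟨A', h', ?_⟩
    simp only [Copies.forget_copyMk, Functor.map_comp, Category.assoc, copyMk_iso_hom_comp]
  choose e h' he using hlift
  rw [← Nat.card_coe_set_eq]
  refine Nat.card_le_card_of_injective e fun x y hxy => Subtype.ext ?_
  have heq : ∀ (A₁ A₂ : {A' : K₁ // U.obj A' = A}) (h₁ : A₁.1 ⟶ B) (h₂ : A₂.1 ⟶ B), A₁ = A₂ →
      χ (Copies.forget U A₁.2 D (copyMk (h₁ ≫ f))) =
        χ (Copies.forget U A₂.2 D (copyMk (h₂ ≫ f))) := by
    rintro A₁ _ h₁ h₂ rfl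
    exact hf A₁ (Finset.mem_univ _) h₁ h₂
  rw [← he x, ← he y]
  exact heq _ _ _ _ hxy

theorem IsPrecompactExpansion.card_expansions_le {U : K₁ ⥤ K₂} (hU : IsPrecompactExpansion U)
    {A B D : K₂} (hB : ∀ (B' : K₁), U.obj B' = B → ∀ (A' : K₁), U.obj A' = A →
      Nonempty (A' ⟶ B')) {t : ℕ}
    (hD : ArrowsRamsey A B D (Nat.card {A' : K₁ // U.obj A' = A}) t) :
    Nat.card {A' : K₁ // U.obj A' = A} ≤ t := by
  have hfin := hU.2 A
  obtain ⟨D, rfl⟩ := hU.1.2.1 D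
  obtain ⟨χ, hχ⟩ := hU.1.exists_expansion_coloring A D
  let e := Finite.equivFin {A' : K₁ // U.obj A' = A}
  obtain ⟨f, hf⟩ := hD (fun c => e (χ c))
  refine le_of_eq_of_le (Eq.symm ?_) hf
  convert Set.ncard_univ (Fin (Nat.card {A' : K₁ // U.obj A' = A})) using 2
  · refine Set.eq_univ_of_forall fun i => ?_
    obtain ⟨⟨B', hB'⟩, ⟨f', g, rfl⟩, -⟩ := hU.1.existsUnique_reflects f
    obtain ⟨h⟩ := hB B' hB' (e.symm i).1 (e.symm i).2
    refine ⟨_, ⟨eqToHom (e.symm i).2.symm ≫ U.map h ≫ eqToHom hB' ≫ g.inv, rfl⟩, ?_⟩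
    exact e.eq_symm_apply.1 (hχ _ _ ⟨h ≫ f', Iso.refl A, by simp⟩)
  · simp

end Expansion

end CatRamsey

open CatRamsey

/-- Let `U : K₁ ⥤ K₂` be a categorical precompact expansion satisfying the
homogeneous condition.  If every object of `K₁` has Ramsey degree `1` in `K₁` (i.e. `K₁` has
the Ramsey property), then for every object `A` of `K₂` the Ramsey degree of `A` in `K₂`
equals its number of expansions `m(A)`. -/
theorem ramseyDegree_eq_card_expansions_of_precompactExpansion
    {K₁ : Type u₁} {K₂ : Type u₂} [Category.{v₁} K₁] [Category.{v₂} K₂]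
    (U : K₁ ⥤ K₂) (hU : IsPrecompactExpansion U)
    (hhom : ∀ A : K₂, ∃ B : K₂, ∀ (B' : K₁), U.obj B' = B → ∀ (A' : K₁), U.obj A' = A →
      Nonempty (A' ⟶ B'))
    (hRP : ∀ A₁ : K₁, ramseyDegree A₁ = 1) :
    ∀ A : K₂, ramseyDegree A = (Nat.card {A' : K₁ // U.obj A' = A} : ℕ∞) := by
  intro A
  apply le_antisymm
  · exact sInf_le ⟨_, rfl, fun B k => hU.exists_arrowsRamsey hRP A B k⟩
  · refine le_sInf ?_
    rintro _ ⟨t, rfl, ht⟩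
    obtain ⟨B, hB⟩ := hhom A
    obtain ⟨D, hD⟩ := ht B (Nat.card {A' : K₁ // U.obj A' = A})
    exact_mod_cast hU.card_expansions_le hB hD
end

section
/- Let U : K₁ ⥤ K₂ be a faithful functor between categories, let F₁ be an object of K₁ and set F₂ = U(F₁). Let A be an object of K₂ and let A^0, …, A^{m−1} be finitely many objects of K₁ with U(A^i) = A for each i. Assume: (i) U induces a bijection from Hom(F₁, F₁) onto Hom(F₂, F₂); (ii) the map from the disjoint union over i < m of (F₁ choose A^i) to (F₂ choose A) sending the class [h] of h : A^i ⟶ F₁ to the class [U(h)] of U(h) : A ⟶ F₂ is a bijection; (iii) each big Ramsey degree T(A^i, F₁) is finite. Then the big Ramsey degree of A in F₂ satisfies T(A, F₂) = Σ_{i < m} T(A^i, F₁). -/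
open CategoryTheory

universe v₁ v₂ u₁ u₂ v u

namespace CatRamsey

variable {C : Type u} [Category.{v} C]

/-- The big Ramsey degree `T(A, F)` : the least `t` such that for every number of colours `k`
and every colouring `χ` of the copies of `A` in `F`, there is `f : F ⟶ F` such that `χ` takes
at most `t` values on the copies of `A` in the image of `F` under `f`; `⊤` if no such `t`
exists. -/
noncomputable def bigRamseyDegree (A F : C) : ℕ∞ :=
  sInf {t : ℕ∞ | ∃ t' : ℕ, t = (t' : ℕ∞) ∧ ∀ (k : ℕ) (χ : Copies A F → Fin k), ∃ f : F ⟶ F,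
    (χ '' {c : Copies A F | ∃ h : A ⟶ F, c = copyMk (h ≫ f)}).ncard ≤ t'}

end CatRamsey

open CatRamsey

namespace CatRamsey

section

variable {C : Type u} [Category.{v} C]

/-- Postcomposition with `f : F ⟶ G` on copies of `A`. -/
def Copies.map (A : C) {F G : C} (f : F ⟶ G) : Copies A F → Copies A G :=
  Quotient.map' (fun h => h ≫ f) (by
    rintro a b ⟨g, hg⟩
    exact ⟨g, by rw [← Category.assoc, hg]⟩)

theorem Copies.map_copyMk {A F G : C} (f : F ⟶ G) (h : A ⟶ F) :
    Copies.map A f (copyMk h) = copyMk (h ≫ f) := rfl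

theorem copyMk_surjective {A F : C} : Function.Surjective (copyMk : (A ⟶ F) → Copies A F) :=
  Quotient.exists_rep

theorem Copies.map_comp {A F G H : C} (f : F ⟶ G) (g : G ⟶ H) :
    Copies.map A (f ≫ g) = Copies.map A g ∘ Copies.map A f := by
  funext c
  obtain ⟨h, rfl⟩ := copyMk_surjective c
  simp [Copies.map_copyMk]

theorem image_copies_eq_range {A F : C} {β : Type*} (χ : Copies A F → β) (f : F ⟶ F) :
    χ '' {c : Copies A F | ∃ h : A ⟶ F, c = copyMk (h ≫ f)} = Set.range (χ ∘ Copies.map A f) := by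
  ext b
  constructor
  · rintro ⟨_, ⟨h, rfl⟩, rfl⟩
    exact ⟨copyMk h, rfl⟩
  · rintro ⟨c, rfl⟩
    obtain ⟨h, rfl⟩ := copyMk_surjective c
    exact ⟨_, ⟨h, rfl⟩, rfl⟩

theorem bigRamseyDegree_le_iff {A F : C} {t : ℕ} :
    bigRamseyDegree A F ≤ t ↔ ∀ (k : ℕ) (χ : Copies A F → Fin k), ∃ f : F ⟶ F,
      (Set.range (χ ∘ Copies.map A f)).ncard ≤ t := by
  simp only [bigRamseyDegree, image_copies_eq_range]
  constructor
  · intro hle k χ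
    have hne : {t : ℕ∞ | ∃ t' : ℕ, t = (t' : ℕ∞) ∧ ∀ (k : ℕ) (χ : Copies A F → Fin k),
        ∃ f : F ⟶ F, (Set.range (χ ∘ Copies.map A f)).ncard ≤ t'}.Nonempty := by
      by_contra hne
      rw [Set.not_nonempty_iff_eq_empty] at hne
      rw [hne, sInf_empty, top_le_iff] at hle
      exact ENat.natCast_ne_top t hle
    obtain ⟨t', ht', hχ⟩ := csInf_mem hne
    rw [ht', Nat.cast_le] at hle
    obtain ⟨f, hf⟩ := hχ k χ
    exact ⟨f, hf.trans hle⟩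
  · intro hχ
    exact sInf_le ⟨t, rfl, hχ⟩

theorem exists_ncard_range_le {A F : C} {t : ℕ} (ht : bigRamseyDegree A F ≤ t) {β : Type*}
    [Finite β] (χ : Copies A F → β) :
    ∃ f : F ⟶ F, (Set.range (χ ∘ Copies.map A f)).ncard ≤ t := by
  obtain ⟨f, hf⟩ := bigRamseyDegree_le_iff.1 ht _ (Finite.equivFin β ∘ χ)
  refine ⟨f, ?_⟩
  rwa [Function.comp_assoc, Set.range_comp,
    Set.ncard_image_of_injective _ (Finite.equivFin β).injective] at hf

/-- A colouring witnessing the minimality of the big Ramsey degree. -/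
theorem exists_coloring_le_ncard_range {A F : C} {t : ℕ} (ht : t ≤ bigRamseyDegree A F) :
    ∃ (k : ℕ) (χ : Copies A F → Fin k),
      ∀ f : F ⟶ F, t ≤ (Set.range (χ ∘ Copies.map A f)).ncard := by
  cases t with
  | zero => exact ⟨1, fun _ => 0, fun _ => Nat.zero_le _⟩
  | succ n =>
    have hn : ¬ bigRamseyDegree A F ≤ n := fun h =>
      absurd (Nat.cast_le.1 (ht.trans h)) (Nat.not_succ_le_self n)
    rw [bigRamseyDegree_le_iff] at hn
    push Not at hn
    exact hn

/-- Finitely many colourings can be controlled simultaneously by one endomorphism. -/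
theorem exists_forall_ncard_range_le {ι : Type*} {F : C} {A : ι → C} {t : ι → ℕ}
    (ht : ∀ i, bigRamseyDegree (A i) F ≤ t i) {β : Type*} [Finite β]
    (χ : ∀ i, Copies (A i) F → β) (s : Finset ι) :
    ∃ f : F ⟶ F, ∀ i ∈ s, (Set.range (χ i ∘ Copies.map (A i) f)).ncard ≤ t i := by
  classical
  induction s using Finset.induction_on with
  | empty => exact ⟨𝟙 F, by simp⟩
  | insert j s _ ih =>
    obtain ⟨f, hf⟩ := ih
    obtain ⟨g, hg⟩ := exists_ncard_range_le (ht j) (χ j ∘ Copies.map (A j) f)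
    refine ⟨g ≫ f, fun i hi => ?_⟩
    rw [Copies.map_comp, ← Function.comp_assoc]
    rcases Finset.mem_insert.1 hi with rfl | hi
    · exact hg
    · exact (Set.ncard_le_ncard (Set.range_comp_subset_range _ _)).trans (hf i hi)

end

end CatRamsey

theorem Set.sum_ncard_range_le_ncard_range_sigmaMap {ι : Type*} [Fintype ι] {α β : ι → Type*}
    [∀ i, Finite (β i)] (g : ∀ i, α i → β i) :
    ∑ i, (Set.range (g i)).ncard ≤ (Set.range (Sigma.map id g)).ncard := by
  simp only [← Nat.card_coe_set_eq]
  rw [← Nat.card_sigma]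
  refine Nat.card_le_card_of_injective
    (fun p => (⟨⟨p.1, p.2.1⟩, by
      obtain ⟨i, _, a, rfl⟩ := p
      exact ⟨⟨i, a⟩, rfl⟩⟩ : Set.range (Sigma.map id g))) ?_
  rintro ⟨i, b, hb⟩ ⟨j, c, hc⟩ h
  simp only [Subtype.mk.injEq, Sigma.mk.injEq] at h
  obtain ⟨rfl, h⟩ := h
  cases h
  rfl

/-- Let `U : K₁ ⥤ K₂` be faithful, `F₂ = U(F₁)`, and let `A^0, …, A^{m-1}`
be objects of `K₁` lying over `A`.  If (i) `U` induces a bijection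
`Hom(F₁,F₁) ≃ Hom(F₂,F₂)`, (ii) the induced map `Σ_{i<m} (F₁ choose A^i) → (F₂ choose A)`,
`[h] ↦ [U(h)]`, is a (well-defined) bijection, and (iii) each `T(A^i, F₁)` is finite, then
`T(A, F₂) = ∑_{i<m} T(A^i, F₁)`. -/
theorem bigRamseyDegree_eq_sum_of_unique_expansion
    {K₁ : Type u₁} {K₂ : Type u₂} [Category.{v₁} K₁] [Category.{v₂} K₂]
    (U : K₁ ⥤ K₂)
    (hfaith : ∀ (X Y : K₁), Function.Injective (fun f : X ⟶ Y => U.map f))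
    (F₁ : K₁) (A : K₂) (m : ℕ) (Aexp : Fin m → K₁) (hA : ∀ i, U.obj (Aexp i) = A)
    (hi : Function.Bijective (fun f : F₁ ⟶ F₁ => U.map f))
    (hii :
      (∀ p : Σ i : Fin m, Copies (Aexp i) F₁, ∃! c : Copies A (U.obj F₁),
        ∃ h : Aexp p.1 ⟶ F₁, p.2 = copyMk h ∧
          c = copyMk (eqToHom (hA p.1).symm ≫ U.map h)) ∧
      (∀ c : Copies A (U.obj F₁), ∃! p : Σ i : Fin m, Copies (Aexp i) F₁,
        ∃ h : Aexp p.1 ⟶ F₁, p.2 = copyMk h ∧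
          c = copyMk (eqToHom (hA p.1).symm ≫ U.map h)))
    (hiii : ∀ i : Fin m, bigRamseyDegree (Aexp i) F₁ ≠ ⊤) :
    bigRamseyDegree A (U.obj F₁) = ∑ i : Fin m, bigRamseyDegree (Aexp i) F₁ := by
  choose e he he_unique using hii.1
  have e_copyMk : ∀ i (h : Aexp i ⟶ F₁),
      e ⟨i, copyMk h⟩ = copyMk (eqToHom (hA i).symm ≫ U.map h) := fun i h =>
    (he_unique ⟨i, copyMk h⟩ _ ⟨h, rfl, rfl⟩).symm
  have e_bij : Function.Bijective e := by
    refine ⟨fun p q hpq => ?_, fun c => ?_⟩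
    · exact (hii.2 (e q)).unique (hpq ▸ he p) (he q)
    · obtain ⟨p, ⟨h, hp, hc⟩, -⟩ := hii.2 c
      exact ⟨p, (he_unique p c ⟨h, hp, hc⟩).symm⟩
  have map_e : ∀ (f : F₁ ⟶ F₁) i (c : Copies (Aexp i) F₁),
      Copies.map A (U.map f) (e ⟨i, c⟩) = e ⟨i, Copies.map (Aexp i) f c⟩ := by
    intro f i c
    obtain ⟨h, rfl⟩ := copyMk_surjective c
    simp [e_copyMk, Copies.map_copyMk]
  choose t ht using fun i => ENat.ne_top_iff_exists.1 (hiii i)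
  have hsum : ∑ i, bigRamseyDegree (Aexp i) F₁ = ((∑ i, t i : ℕ) : ℕ∞) := by
    rw [Nat.cast_sum]
    exact Finset.sum_congr rfl fun i _ => (ht i).symm
  rw [hsum]
  apply le_antisymm
  · rw [bigRamseyDegree_le_iff]
    intro k χ
    obtain ⟨f, hf⟩ := exists_forall_ncard_range_le (fun i => (ht i).ge)
      (fun i c => χ (e ⟨i, c⟩)) Finset.univ
    refine ⟨U.map f, ?_⟩
    have hsub : Set.range (χ ∘ Copies.map A (U.map f)) ⊆
        ⋃ i, Set.range ((fun c => χ (e ⟨i, c⟩)) ∘ Copies.map (Aexp i) f) := by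
      rintro _ ⟨c, rfl⟩
      obtain ⟨⟨i, c⟩, rfl⟩ := e_bij.2 c
      exact Set.mem_iUnion.2 ⟨i, c, by simp [map_e]⟩
    calc _ ≤ _ := Set.ncard_le_ncard hsub
      _ ≤ _ := Set.ncard_iUnion_le_of_fintype _
      _ ≤ _ := Finset.sum_le_sum hf
  · cases hT : bigRamseyDegree A (U.obj F₁) with
    | top => exact le_top
    | coe T =>
      choose k χ hχ using fun i => exists_coloring_le_ncard_range (ht i).le
      let E := Equiv.ofBijective e e_bij
      obtain ⟨g, hg⟩ := exists_ncard_range_le hT.le (Sigma.map (β₂ := fun i => Fin (k i)) id χ ∘ E.symm)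
      obtain ⟨f, rfl⟩ := hi.2 g
      have hrange : Set.range ((Sigma.map (β₂ := fun i => Fin (k i)) id χ ∘ E.symm) ∘ Copies.map A (U.map f)) =
          Set.range (Sigma.map (β₂ := fun i => Fin (k i)) id fun i => χ i ∘ Copies.map (Aexp i) f) := by
        rw [← E.surjective.range_comp]
        congr 1
        funext ⟨i, c⟩
        have : E.symm (Copies.map A (U.map f) (E ⟨i, c⟩)) = ⟨i, Copies.map (Aexp i) f c⟩ := by
          rw [Equiv.symm_apply_eq]
          exact map_e f i c
        simp only [Function.comp_apply, this]
        rfl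
      rw [Nat.cast_le]
      calc _ ≤ _ := Finset.sum_le_sum fun i _ => hχ i f
        _ ≤ _ := Set.sum_ncard_range_le_ncard_range_sigmaMap _
        _ = _ := congrArg Set.ncard hrange.symm
        _ ≤ _ := hg
end
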